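/- For 0 < α ≤ 2, the function N_α(x,1) = α·x^(α/2)·(x-1)/(x^α - 1) is monotone increasing in x > 0, and satisfies 1 ≤ N_α(x,1) ≤ x for all x ≥ 1. -/

import Mathlib

noncomputable def NalphaOne (α x : ℝ) : ℝ :=
  if x = 1 then 1 else α * x ^ (α / 2) * (x - 1) / (x ^ α - 1)

open Set in
/-- A differentiable function vanishing at `0` whose derivative has the sign of its argument is
nonnegative. -/
lemma nonneg_of_hasDerivAt_sign {f f' : ℝ → ℝ} (h0 : f 0 = 0)
    (hf : ∀ t, HasDerivAt f (f' t) t) (hpos : ∀ t, 0 < t → 0 ≤ f' t)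
    (hneg : ∀ t, t < 0 → f' t ≤ 0) (t : ℝ) : 0 ≤ f t := by
  have hc : Continuous f := continuous_iff_continuousAt.2 fun t => (hf t).continuousAt
  rcases le_total 0 t with ht | ht
  · have hm : MonotoneOn f (Ici 0) := by
      refine monotoneOn_of_hasDerivWithinAt_nonneg (convex_Ici 0) hc.continuousOn
        (fun x _ => (hf x).hasDerivWithinAt) fun x hx => hpos x ?_
      simpa using hx
    simpa [h0] using hm self_mem_Ici ht ht
  · have hm : AntitoneOn f (Iic 0) := by
      refine antitoneOn_of_hasDerivWithinAt_nonpos (convex_Iic 0) hc.continuousOn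
        (fun x _ => (hf x).hasDerivWithinAt) fun x hx => hneg x ?_
      simpa using hx
    simpa [h0] using hm ht self_mem_Iic ht

lemma hasDerivAt_exp_two_mul (t : ℝ) :
    HasDerivAt (fun t => Real.exp (2 * t)) (2 * Real.exp (2 * t)) t := by
  simpa [mul_comm] using ((hasDerivAt_id t).const_mul 2).exp

lemma hasDerivAt_sinh_const_mul (α t : ℝ) :
    HasDerivAt (fun t => Real.sinh (α * t)) (α * Real.cosh (α * t)) t := by
  simpa [mul_comm] using ((hasDerivAt_id t).const_mul α).sinh

lemma hasDerivAt_cosh_const_mul (α t : ℝ) :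
    HasDerivAt (fun t => Real.cosh (α * t)) (α * Real.sinh (α * t)) t := by
  simpa [mul_comm] using ((hasDerivAt_id t).const_mul α).cosh

lemma two_mul_sinh_le {α : ℝ} (hα0 : 0 < α) (hα2 : α ≤ 2) (t : ℝ) :
    2 * Real.sinh (α * t) ≤ α * (Real.exp (2 * t) - 1) := by
  have hd (t : ℝ) : HasDerivAt
      (fun t => α * (Real.exp (2 * t) - 1) - 2 * Real.sinh (α * t))
      (2 * α * (Real.exp (2 * t) - Real.cosh (α * t))) t := by
    refine HasDerivAt.congr_deriv ((((hasDerivAt_exp_two_mul t).sub_const 1).const_mul α).sub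
      ((hasDerivAt_sinh_const_mul α t).const_mul 2)) ?_
    ring
  have := nonneg_of_hasDerivAt_sign (by simp) hd ?_ ?_ t
  · linarith
  · intro t ht
    have h1 : Real.exp (α * t) ≤ Real.exp (2 * t) := Real.exp_le_exp.2 (by nlinarith)
    have h2 : Real.exp (-(α * t)) ≤ Real.exp (2 * t) := Real.exp_le_exp.2 (by nlinarith)
    have h3 := Real.cosh_eq (α * t)
    exact mul_nonneg (by positivity) (by linarith)
  · intro t ht
    have h1 : Real.exp (2 * t) ≤ 1 := Real.exp_le_one_iff.2 (by linarith)
    have h2 := Real.one_le_cosh (α * t)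
    exact mul_nonpos_of_nonneg_of_nonpos (by positivity) (by linarith)

lemma mul_exp_sub_one_mul_cosh_le {α : ℝ} (hα0 : 0 < α) (hα2 : α ≤ 2) (t : ℝ) :
    α * (Real.exp (2 * t) - 1) * Real.cosh (α * t) ≤
      2 * Real.exp (2 * t) * Real.sinh (α * t) := by
  have hd (t : ℝ) : HasDerivAt
      (fun t => 2 * Real.exp (2 * t) * Real.sinh (α * t) -
        α * (Real.exp (2 * t) - 1) * Real.cosh (α * t))
      (((4 - α ^ 2) * Real.exp (2 * t) + α ^ 2) * Real.sinh (α * t)) t := by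
    refine HasDerivAt.congr_deriv ((((hasDerivAt_exp_two_mul t).const_mul 2).mul
      (hasDerivAt_sinh_const_mul α t)).sub
      ((((hasDerivAt_exp_two_mul t).sub_const 1).const_mul α).mul
        (hasDerivAt_cosh_const_mul α t))) ?_
    ring
  have hfac (t : ℝ) : 0 ≤ (4 - α ^ 2) * Real.exp (2 * t) + α ^ 2 := by
    have : 0 ≤ 4 - α ^ 2 := by nlinarith
    positivity
  have := nonneg_of_hasDerivAt_sign (by simp) hd
    (fun t ht => mul_nonneg (hfac t) (Real.sinh_nonneg_iff.2 (by positivity)))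
    (fun t ht => mul_nonpos_of_nonneg_of_nonpos (hfac t)
      (Real.sinh_nonpos_iff.2 (by nlinarith))) t
  linarith

lemma NalphaOne_one (α : ℝ) : NalphaOne α 1 = 1 := if_pos rfl

lemma NalphaOne_exp_two_mul {α t : ℝ} (hα0 : 0 < α) (ht : t ≠ 0) :
    NalphaOne α (Real.exp (2 * t)) =
      α * (Real.exp (2 * t) - 1) / (2 * Real.sinh (α * t)) := by
  have hs : Real.sinh (α * t) ≠ 0 := by simp [hα0.ne', ht]
  have h1 : Real.exp (2 * t) ^ (α / 2) = Real.exp (α * t) := by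
    rw [← Real.exp_mul]; ring_nf
  have h2 : Real.exp (2 * t) ^ α - 1 = Real.exp (α * t) * (2 * Real.sinh (α * t)) := by
    have h : Real.exp (α * t) * Real.exp (-(α * t)) = 1 := by rw [← Real.exp_add]; simp
    have h' : Real.exp (2 * t) ^ α = Real.exp (α * t) * Real.exp (α * t) := by
      rw [← Real.exp_mul, ← Real.exp_add]; ring_nf
    rw [h', Real.sinh_eq]
    linear_combination h
  rw [NalphaOne, if_neg (by simpa using ht), h1, h2]
  have := Real.exp_ne_zero (α * t)
  field_simp

lemma one_le_NalphaOne_exp {α t : ℝ} (hα0 : 0 < α) (hα2 : α ≤ 2) (ht : 0 < t) :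
    1 ≤ NalphaOne α (Real.exp (2 * t)) := by
  have hs : 0 < Real.sinh (α * t) := Real.sinh_pos_iff.2 (by positivity)
  rw [NalphaOne_exp_two_mul hα0 ht.ne', one_le_div (by positivity)]
  exact two_mul_sinh_le hα0 hα2 t

lemma NalphaOne_exp_le_one {α t : ℝ} (hα0 : 0 < α) (hα2 : α ≤ 2) (ht : t < 0) :
    NalphaOne α (Real.exp (2 * t)) ≤ 1 := by
  have hs : Real.sinh (α * t) < 0 := Real.sinh_neg_iff.2 (by nlinarith)
  rw [NalphaOne_exp_two_mul hα0 ht.ne, div_le_one_of_neg (by linarith)]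
  exact two_mul_sinh_le hα0 hα2 t

lemma NalphaOne_exp_le_self {α t : ℝ} (hα0 : 0 < α) (hα2 : α ≤ 2) (ht : 0 < t) :
    NalphaOne α (Real.exp (2 * t)) ≤ Real.exp (2 * t) := by
  have hs : 0 < Real.sinh (α * t) := Real.sinh_pos_iff.2 (by positivity)
  rw [NalphaOne_exp_two_mul hα0 ht.ne', div_le_iff₀ (by positivity)]
  have h := two_mul_sinh_le hα0 hα2 (-t)
  rw [mul_neg, mul_neg, Real.sinh_neg] at h
  have he : Real.exp (2 * t) * Real.exp (-(2 * t)) = 1 := by rw [← Real.exp_add]; simp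
  linear_combination Real.exp (2 * t) * h + α * he

lemma monotoneOn_NalphaOne_exp {α : ℝ} (hα0 : 0 < α) (hα2 : α ≤ 2) {s : Set ℝ}
    (hs : Convex ℝ s) (h0 : ∀ t ∈ s, t ≠ 0) :
    MonotoneOn (fun t => NalphaOne α (Real.exp (2 * t))) s := by
  have hd (t : ℝ) (ht : t ∈ s) : HasDerivAt
      (fun t => α * (Real.exp (2 * t) - 1) / (2 * Real.sinh (α * t)))
      (2 * α * (2 * Real.exp (2 * t) * Real.sinh (α * t) -
        α * (Real.exp (2 * t) - 1) * Real.cosh (α * t)) / (2 * Real.sinh (α * t)) ^ 2) t := by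
    have hne : 2 * Real.sinh (α * t) ≠ 0 := by simp [hα0.ne', h0 t ht]
    refine HasDerivAt.congr_deriv ((((hasDerivAt_exp_two_mul t).sub_const 1).const_mul α).div
      ((hasDerivAt_sinh_const_mul α t).const_mul 2) hne) ?_
    ring
  refine (monotoneOn_of_hasDerivWithinAt_nonneg hs
    (fun t ht => (hd t ht).continuousAt.continuousWithinAt)
    (fun t ht => (hd t (interior_subset ht)).hasDerivWithinAt) fun t _ => ?_).congr
    fun t ht => (NalphaOne_exp_two_mul hα0 (h0 t ht)).symm
  have := sub_nonneg.2 (mul_exp_sub_one_mul_cosh_le hα0 hα2 t)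
  positivity

lemma monotone_NalphaOne_exp {α : ℝ} (hα0 : 0 < α) (hα2 : α ≤ 2) :
    Monotone (fun t => NalphaOne α (Real.exp (2 * t))) := by
  intro s t hst
  rcases lt_trichotomy t 0 with ht | rfl | ht
  · exact monotoneOn_NalphaOne_exp hα0 hα2 (convex_Iio 0) (fun _ h => ne_of_lt h)
      (lt_of_le_of_lt hst ht) ht hst
  · rcases hst.lt_or_eq with hs | rfl
    · simpa [NalphaOne_one] using NalphaOne_exp_le_one hα0 hα2 hs
    · exact le_rfl
  · rcases lt_trichotomy s 0 with hs | rfl | hs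
    · exact (NalphaOne_exp_le_one hα0 hα2 hs).trans (one_le_NalphaOne_exp hα0 hα2 ht)
    · simpa [NalphaOne_one] using one_le_NalphaOne_exp hα0 hα2 ht
    · exact monotoneOn_NalphaOne_exp hα0 hα2 (convex_Ioi 0) (fun _ h => ne_of_gt h) hs ht hst

theorem stmt9 (α : ℝ) (hα0 : 0 < α) (hα2 : α ≤ 2) :
    MonotoneOn (fun x => NalphaOne α x) (Set.Ioi (0 : ℝ)) ∧
      ∀ x : ℝ, 1 ≤ x → 1 ≤ NalphaOne α x ∧ NalphaOne α x ≤ x := by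
  have hexp {x : ℝ} (hx : 0 < x) : Real.exp (2 * (Real.log x / 2)) = x := by
    rw [mul_div_cancel₀ _ two_ne_zero, Real.exp_log hx]
  refine ⟨fun x hx y hy hxy => ?_, fun x hx => ?_⟩
  · have h := monotone_NalphaOne_exp hα0 hα2
      (div_le_div_of_nonneg_right (Real.log_le_log hx hxy) zero_le_two)
    simpa only [hexp hx, hexp hy] using h
  · rcases hx.eq_or_lt with rfl | hx
    · simp [NalphaOne_one]
    · have ht : 0 < Real.log x / 2 := half_pos (Real.log_pos hx)
      have h1 := one_le_NalphaOne_exp hα0 hα2 ht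
      have h2 := NalphaOne_exp_le_self hα0 hα2 ht
      rw [hexp (one_pos.trans hx)] at h1 h2
      exact ⟨h1, h2⟩
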